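/- arXiv:0801.3105 — 2 statements merged into one kernel-verified Lean document; each statement's English description precedes it below -/
import Mathlib

section
/- If {f_1,…,f_N} and {g_1,…,g_M'} are two finite generating sets of the same ideal I ⊆ R = ℂ[x_1,…,x_n], then for every d ≥ 1 the deflation ideals of order d built from the two generating sets are equal as ideals of S; that is, the deflation ideal I^{(d)} does not depend on the set of generators of I chosen to construct it. -/
open MvPolynomial

noncomputable section NPD
/-- The iterated partial derivative `∂^β = ∂^{|β|}/∂x₁^{β₁}⋯∂xₙ^{βₙ}` on
`R = ℂ[x₁,…,xₙ]`, as a `ℂ`-linear endomorphism. -/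
def pd {n : ℕ} (β : Fin n →₀ ℕ) : Module.End ℂ (MvPolynomial (Fin n) ℂ) :=
  (List.ofFn fun i : Fin n =>
    ((pderiv i).toLinearMap : Module.End ℂ (MvPolynomial (Fin n) ℂ)) ^ (β i)).prod
/-- The index type for the deflation variables `a_β`: multi-indices `β` with `|β| ≤ d`. -/
def AIdx (n d : ℕ) : Type := {β : Fin n →₀ ℕ // β.degree ≤ d}

noncomputable instance AIdx.fintype (n d : ℕ) : Fintype (AIdx n d) := by
  have hfin : {β : Fin n →₀ ℕ | β.degree ≤ d}.Finite := by
    apply Set.Finite.subset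
      (Finset.Iic (Finsupp.equivFunOnFinite.symm fun _ : Fin n => d)).finite_toSet
    intro β hβ
    simp only [Finset.coe_Iic, Set.mem_Iic]
    rw [Finsupp.le_def]
    intro i
    simpa using le_trans (Finsupp.le_degree i β) hβ
  exact hfin.fintype

/-- The generator `Σ_{|β| ≤ d} a_β · ∂^β g` of the deflation ideal attached to a
polynomial `g`, an element of `S = R[a_β : |β| ≤ d]`. -/
def deflGen {n : ℕ} (d : ℕ) (g : MvPolynomial (Fin n) ℂ) :
    MvPolynomial (Fin n ⊕ AIdx n d) ℂ :=
  ∑ β : AIdx n d, X (Sum.inr β) * rename Sum.inl (pd β.1 g)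

/-- The deflation ideal `I^{(d)} ⊆ S` of order `d` of the ideal generated by
`f 0, …, f (N-1)`: it is generated by the `f j` together with the polynomials
`Σ_{|β| ≤ d} a_β · ∂^β (x^α f j)` for all `j` and all multi-indices `α` with `|α| < d`. -/
def deflIdeal {n : ℕ} (d : ℕ) {N : ℕ} (f : Fin N → MvPolynomial (Fin n) ℂ) :
    Ideal (MvPolynomial (Fin n ⊕ AIdx n d) ℂ) :=
  Ideal.span
    ((Set.range fun j : Fin N => (rename Sum.inl (f j) : MvPolynomial (Fin n ⊕ AIdx n d) ℂ)) ∪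
      Set.range fun p : Fin N × {α : Fin n →₀ ℕ // α.degree < d} =>
        deflGen d (monomial p.2.1 1 * f p.1))
section Order

variable {σ R S : Type*} [CommRing R] [CommRing S] [Algebra R S]

/-- The commutator of a linear map `D` with multiplication by the variable `X i`, where
`MvPolynomial σ R` acts on the target through `φ`. -/
def commX (φ : MvPolynomial σ R →ₐ[R] S) (i : σ) (D : MvPolynomial σ R →ₗ[R] S) :
    MvPolynomial σ R →ₗ[R] S :=
  D ∘ₗ LinearMap.mulLeft R (X i) - LinearMap.mulLeft R (φ (X i)) ∘ₗ D

theorem commX_apply (φ : MvPolynomial σ R →ₐ[R] S) (i : σ) (D : MvPolynomial σ R →ₗ[R] S)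
    (p : MvPolynomial σ R) : commX φ i D p = D (X i * p) - φ (X i) * D p := rfl

/-- `D` is a differential operator of order less than `k`, in the sense of Grothendieck:
all `k`-fold iterated commutators with variables vanish. -/
def OrderLT (φ : MvPolynomial σ R →ₐ[R] S) : ℕ → (MvPolynomial σ R →ₗ[R] S) → Prop
  | 0, D => D = 0
  | k + 1, D => ∀ i, OrderLT φ k (commX φ i D)

variable {φ : MvPolynomial σ R →ₐ[R] S}

theorem OrderLT.zero (k : ℕ) : OrderLT φ k 0 := by
  induction k with
  | zero => rfl
  | succ k ih =>
    intro i
    have h : commX φ i 0 = 0 := by ext; simp [commX_apply]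
    rwa [h]

theorem OrderLT.add {k : ℕ} {D E : MvPolynomial σ R →ₗ[R] S} (hD : OrderLT φ k D)
    (hE : OrderLT φ k E) : OrderLT φ k (D + E) := by
  induction k generalizing D E with
  | zero => simp_all [OrderLT]
  | succ k ih =>
    intro i
    have h : commX φ i (D + E) = commX φ i D + commX φ i E := by
      refine LinearMap.ext fun p => ?_
      simp only [commX_apply, LinearMap.add_apply]
      ring
    rw [h]
    exact ih (hD i) (hE i)

theorem OrderLT.succ {k : ℕ} {D : MvPolynomial σ R →ₗ[R] S} (hD : OrderLT φ k D) :
    OrderLT φ (k + 1) D := by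
  induction k generalizing D with
  | zero =>
    obtain rfl : D = 0 := hD
    exact .zero 1
  | succ k ih => exact fun i => ih (hD i)

theorem OrderLT.mono {k l : ℕ} {D : MvPolynomial σ R →ₗ[R] S} (hD : OrderLT φ k D)
    (hkl : k ≤ l) : OrderLT φ l D :=
  Nat.le_induction hD (fun _ _ => OrderLT.succ) l hkl

theorem OrderLT.sum {ι : Type*} {k : ℕ} {D : ι → MvPolynomial σ R →ₗ[R] S} (s : Finset ι)
    (hD : ∀ i ∈ s, OrderLT φ k (D i)) : OrderLT φ k (∑ i ∈ s, D i) :=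
  Finset.sum_induction _ _ (fun _ _ => OrderLT.add) (.zero k) hD

theorem OrderLT.mulLeft_comp {k : ℕ} {D : MvPolynomial σ R →ₗ[R] S} (hD : OrderLT φ k D)
    (s : S) : OrderLT φ k (LinearMap.mulLeft R s ∘ₗ D) := by
  induction k generalizing D with
  | zero =>
    obtain rfl : D = 0 := hD
    exact LinearMap.comp_zero _
  | succ k ih =>
    intro i
    have h : commX φ i (LinearMap.mulLeft R s ∘ₗ D) = LinearMap.mulLeft R s ∘ₗ commX φ i D := by
      refine LinearMap.ext fun p => ?_
      simp only [commX_apply, LinearMap.comp_apply, LinearMap.mulLeft_apply]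
      ring
    rw [h]
    exact ih (hD i)

theorem OrderLT.algHom_comp {k : ℕ} {A : Module.End R (MvPolynomial σ R)}
    (hA : OrderLT (AlgHom.id R _) k A) : OrderLT φ k (φ.toLinearMap ∘ₗ A) := by
  induction k generalizing A with
  | zero =>
    obtain rfl : A = 0 := hA
    exact LinearMap.comp_zero _
  | succ k ih =>
    intro i
    have h : commX φ i (φ.toLinearMap ∘ₗ A) = φ.toLinearMap ∘ₗ commX (AlgHom.id R _) i A := by
      refine LinearMap.ext fun p => ?_
      simp [commX_apply]
    rw [h]
    exact ih (hA i)

theorem OrderLT.one : OrderLT (AlgHom.id R (MvPolynomial σ R)) 1 1 := fun i =>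
  LinearMap.ext fun p => by simp [commX_apply]

theorem OrderLT.pderiv_mul {k : ℕ} {A : Module.End R (MvPolynomial σ R)}
    (hA : OrderLT (AlgHom.id R _) k A) (j : σ) :
    OrderLT (AlgHom.id R _) (k + 1) ((pderiv j).toLinearMap * A) := by
  induction k generalizing A with
  | zero =>
    obtain rfl : A = 0 := hA
    rw [mul_zero]
    exact .zero 1
  | succ k ih =>
    intro i
    have h : commX (AlgHom.id R _) i ((pderiv j).toLinearMap * A) =
        (pderiv j).toLinearMap * commX (AlgHom.id R _) i A +
          LinearMap.mulLeft R (pderiv j (X i)) ∘ₗ A := by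
      refine LinearMap.ext fun p => ?_
      simp only [commX_apply, Module.End.mul_apply, LinearMap.add_apply, LinearMap.comp_apply,
        LinearMap.mulLeft_apply, AlgHom.id_apply,
        Derivation.coeFn_coe, map_sub, Derivation.leibniz, smul_eq_mul]
      ring
    rw [h]
    exact (ih (hA i)).add (hA.mulLeft_comp _)

theorem OrderLT.pderiv_pow_mul {k : ℕ} {A : Module.End R (MvPolynomial σ R)}
    (hA : OrderLT (AlgHom.id R _) k A) (j : σ) (b : ℕ) :
    OrderLT (AlgHom.id R _) (k + b)
      (((pderiv j).toLinearMap : Module.End R (MvPolynomial σ R)) ^ b * A) := by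
  induction b with
  | zero => simpa using hA
  | succ b ih =>
    rw [pow_succ', mul_assoc]
    exact ih.pderiv_mul j

theorem OrderLT.prod_pderiv_pow {m : ℕ} (v : Fin m → σ) (b : Fin m → ℕ) :
    OrderLT (AlgHom.id R _) (1 + ∑ i, b i)
      (List.ofFn fun i =>
        ((pderiv (v i)).toLinearMap : Module.End R (MvPolynomial σ R)) ^ b i).prod := by
  induction m with
  | zero => simpa using OrderLT.one
  | succ m ih =>
    rw [List.ofFn_succ, List.prod_cons, Fin.sum_univ_succ, add_comm (b 0), ← add_assoc]
    exact (ih (fun i => v i.succ) fun i => b i.succ).pderiv_pow_mul _ _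

/-- A linear map commuting with the variables modulo `J` on multiples of `f` maps all multiples
of `f` into `J` as soon as it maps `f` into `J`. -/
theorem apply_mul_mem_of_commX_mem {J : Ideal S} {D : MvPolynomial σ R →ₗ[R] S}
    {f : MvPolynomial σ R} (hf : D f ∈ J) (hD : ∀ i p, commX φ i D (p * f) ∈ J)
    (p : MvPolynomial σ R) : D (p * f) ∈ J := by
  induction p using MvPolynomial.induction_on with
  | C a =>
    rw [← smul_eq_C_mul, map_smul, Algebra.smul_def]
    exact J.mul_mem_left _ hf
  | add p q hp hq =>
    rw [add_mul, map_add]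
    exact J.add_mem hp hq
  | mul_X p i hp =>
    have h : D (p * X i * f) = commX φ i D (p * f) + φ (X i) * D (p * f) := by
      rw [commX_apply, sub_add_cancel]
      congr 1
      ring
    rw [h]
    exact J.add_mem (hD i p) (J.mul_mem_left _ hp)

/-- A map of order zero is linear over the polynomial ring. -/
theorem OrderLT.apply_mul_of_one {D : MvPolynomial σ R →ₗ[R] S} (hD : OrderLT φ 1 D)
    (p q : MvPolynomial σ R) : D (p * q) = φ p * D q := by
  induction p using MvPolynomial.induction_on generalizing q with
  | C a => rw [← smul_eq_C_mul, map_smul, Algebra.smul_def, ← algebraMap_eq, φ.commutes]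
  | add p r hp hr => rw [add_mul, map_add, hp, hr, map_add, add_mul]
  | mul_X p i hp =>
    have h : D (X i * q) - φ (X i) * D q = 0 := DFunLike.congr_fun (hD i) q
    rw [mul_assoc, hp, sub_eq_zero.mp h, map_mul, mul_assoc]

/-- If a differential operator of order at most `k` maps `x^α f` into `J` for all `|α| < k`,
and `f` itself lies in `J`, then it maps all multiples of `f` into `J`. -/
theorem OrderLT.apply_mul_mem {J : Ideal S} {f : MvPolynomial σ R} (hf : φ f ∈ J) {k : ℕ}
    {D : MvPolynomial σ R →ₗ[R] S} (hD : OrderLT φ (k + 1) D)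
    (hα : ∀ α : σ →₀ ℕ, α.degree < k → D (monomial α 1 * f) ∈ J) (p : MvPolynomial σ R) :
    D (p * f) ∈ J := by
  induction k generalizing D p with
  | zero =>
    rw [mul_comm, hD.apply_mul_of_one]
    exact J.mul_mem_right _ hf
  | succ k ih =>
    refine apply_mul_mem_of_commX_mem (φ := φ) ?_ (fun i => ih (hD i) fun α hk => ?_) p
    · simpa using hα 0 (by simp)
    · rw [commX_apply]
      refine J.sub_mem ?_ (J.mul_mem_left _ (hα α (by omega)))
      have h : X i * (monomial α (1 : R) * f) = monomial (Finsupp.single i 1 + α) 1 * f := by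
        rw [← mul_assoc, X, monomial_mul, one_mul]
      rw [h]
      exact hα _ (by rw [map_add, Finsupp.degree_single]; omega)

end Order

/-- The operator `Σ_{|β| ≤ d} a_β ∂^β` as a linear map. -/
def deflOp (n d : ℕ) :
    MvPolynomial (Fin n) ℂ →ₗ[ℂ] MvPolynomial (Fin n ⊕ AIdx n d) ℂ :=
  ∑ β : AIdx n d, LinearMap.mulLeft ℂ (X (Sum.inr β)) ∘ₗ
    (rename Sum.inl : _ →ₐ[ℂ] MvPolynomial (Fin n ⊕ AIdx n d) ℂ).toLinearMap ∘ₗ pd β.1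

theorem deflOp_apply {n d : ℕ} (p : MvPolynomial (Fin n) ℂ) : deflOp n d p = deflGen d p := by
  simp [deflOp, deflGen]

theorem orderLT_pd {n : ℕ} (β : Fin n →₀ ℕ) :
    OrderLT (AlgHom.id ℂ _) (1 + β.degree) (pd β) := by
  rw [Finsupp.degree_eq_sum]
  exact .prod_pderiv_pow id β

theorem orderLT_deflOp (n d : ℕ) : OrderLT (rename Sum.inl) (d + 1) (deflOp n d) :=
  .sum _ fun β _ =>
    (OrderLT.algHom_comp ((orderLT_pd β.1).mono (by have := β.2; omega))).mulLeft_comp _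

theorem rename_mem_deflIdeal {n N d : ℕ} (f : Fin N → MvPolynomial (Fin n) ℂ)
    {p : MvPolynomial (Fin n) ℂ} (hp : p ∈ Ideal.span (Set.range f)) :
    rename Sum.inl p ∈ deflIdeal d f := by
  have h : Ideal.span (Set.range f) ≤ (deflIdeal d f).comap (rename Sum.inl) := by
    rw [Ideal.span_le]
    rintro _ ⟨j, rfl⟩
    exact Ideal.subset_span (Or.inl ⟨j, rfl⟩)
  exact h hp

theorem deflGen_mem_deflIdeal {n N d : ℕ} (f : Fin N → MvPolynomial (Fin n) ℂ)
    {p : MvPolynomial (Fin n) ℂ} (hp : p ∈ Ideal.span (Set.range f)) :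
    deflGen d p ∈ deflIdeal d f := by
  rw [← deflOp_apply]
  obtain ⟨c, rfl⟩ := Ideal.mem_span_range_iff_exists_fun.mp hp
  rw [map_sum]
  refine Ideal.sum_mem _ fun j _ => (orderLT_deflOp n d).apply_mul_mem
    (rename_mem_deflIdeal f (Ideal.subset_span ⟨j, rfl⟩)) (fun α hα => ?_) _
  rw [deflOp_apply]
  exact Ideal.subset_span (Or.inr ⟨(j, ⟨α, hα⟩), rfl⟩)

theorem deflIdeal_le_of_span_le {n N M : ℕ} {f : Fin N → MvPolynomial (Fin n) ℂ}
    {g : Fin M → MvPolynomial (Fin n) ℂ}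
    (h : Ideal.span (Set.range f) ≤ Ideal.span (Set.range g)) (d : ℕ) :
    deflIdeal d f ≤ deflIdeal d g := by
  have hf (j : Fin N) : f j ∈ Ideal.span (Set.range g) := h (Ideal.subset_span ⟨j, rfl⟩)
  refine Ideal.span_le.mpr ?_
  rintro _ (⟨j, rfl⟩ | ⟨⟨j, α⟩, rfl⟩)
  · exact rename_mem_deflIdeal g (hf j)
  · exact deflGen_mem_deflIdeal g (Ideal.mul_mem_left _ _ (hf j))

/-- **Proposition (deflation independence).** If two finite families generate the same ideal
`I ⊆ ℂ[x₁,…,xₙ]`, then for every `d ≥ 1` the deflation ideals of order `d` built from the two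
generating sets are equal as ideals of `S = R[a_β : |β| ≤ d]`. -/
theorem deflIdeal_eq_of_span_eq {n N M' : ℕ}
    (f : Fin N → MvPolynomial (Fin n) ℂ) (g : Fin M' → MvPolynomial (Fin n) ℂ)
    (h : Ideal.span (Set.range f) = Ideal.span (Set.range g)) (d : ℕ) (hd : 1 ≤ d) :
    deflIdeal d f = deflIdeal d g := by
  exact le_antisymm (deflIdeal_le_of_span_le h.le d) (deflIdeal_le_of_span_le h.ge d)
end NPD
end

section
/- Let I ⊆ R = ℂ[x_1,…,x_n] be an ideal, y ∈ ℂ^n, and 1 ≤ i ≤ n. If Q = Σ_β c_β Δ_y^β belongs to the dual space D_y[I], then the functional χ_i Q := Σ_β c_β β_i Δ_y^{β − e_i} (sum over β with β_i ≥ 1, where e_i is the i-th standard multi-index) also belongs to D_y[I]; that is, D_y[I] is stable under the differentiation operators χ_i. -/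
open MvPolynomial

noncomputable section NPD
/-- The functional `f ↦ Σ_β c_β Δ_y^β(f) = Σ_β c_β (∂^β f)(y)` attached to a finitely
supported family of coefficients `c`. -/
def dualApply {n : ℕ} (y : Fin n → ℂ) (c : (Fin n →₀ ℕ) →₀ ℂ) :
    MvPolynomial (Fin n) ℂ → ℂ :=
  fun f => c.sum fun β cβ => cβ * eval y (pd β f)

lemma dualApply_add {n : ℕ} (y : Fin n → ℂ) (c₁ c₂ : (Fin n →₀ ℕ) →₀ ℂ) :
    dualApply y (c₁ + c₂) = dualApply y c₁ + dualApply y c₂ := by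
  funext f
  exact Finsupp.sum_add_index' (fun β => zero_mul _) (fun β b₁ b₂ => add_mul _ _ _)

lemma dualApply_smul {n : ℕ} (y : Fin n → ℂ) (a : ℂ) (c : (Fin n →₀ ℕ) →₀ ℂ) :
    dualApply y (a • c) = a • dualApply y c := by
  funext f
  show (a • c).sum (fun β cβ => cβ * eval y (pd β f)) = a * c.sum fun β cβ => cβ * eval y (pd β f)
  rw [Finsupp.sum_smul_index' (h := fun β cβ => cβ * eval y (pd β f)) (fun β => zero_mul _),
    Finsupp.mul_sum]
  simp [mul_assoc]

lemma dualApply_zero {n : ℕ} (y : Fin n → ℂ) : dualApply y 0 = 0 := by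
  funext f; exact Finsupp.sum_zero_index

/-- The dual space `D_y[I]`: the space of functionals `Q = Σ_β c_β Δ_y^β` (finite sums)
that annihilate every element of `I`. -/
def DualSpace {n : ℕ} (I : Ideal (MvPolynomial (Fin n) ℂ)) (y : Fin n → ℂ) :
    Submodule ℂ (MvPolynomial (Fin n) ℂ → ℂ) where
  carrier := {Q | (∃ c : (Fin n →₀ ℕ) →₀ ℂ, Q = dualApply y c) ∧ ∀ f ∈ I, Q f = 0}
  add_mem' := by
    rintro Q₁ Q₂ ⟨⟨c₁, rfl⟩, h₁⟩ ⟨⟨c₂, rfl⟩, h₂⟩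
    exact ⟨⟨c₁ + c₂, (dualApply_add y c₁ c₂).symm⟩,
      fun f hf => by simp [dualApply_add, h₁ f hf, h₂ f hf]⟩
  zero_mem' := ⟨⟨0, (dualApply_zero y).symm⟩, fun f _ => rfl⟩
  smul_mem' := by
    rintro a Q ⟨⟨c, rfl⟩, h⟩
    exact ⟨⟨a • c, (dualApply_smul y a c).symm⟩,
      fun f hf => by simp [h f hf]⟩

/-- The truncated dual space `D_y^{(d)}[I] ⊆ D_y[I]`: those functionals
`Q = Σ_β c_β Δ_y^β` annihilating `I` with `c_β = 0` whenever `|β| > d`. -/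
def DualSpaceTrunc {n : ℕ} (I : Ideal (MvPolynomial (Fin n) ℂ)) (y : Fin n → ℂ) (d : ℕ) :
    Submodule ℂ (MvPolynomial (Fin n) ℂ → ℂ) where
  carrier := {Q | (∃ c : (Fin n →₀ ℕ) →₀ ℂ,
      (∀ β : Fin n →₀ ℕ, d < β.degree → c β = 0) ∧ Q = dualApply y c) ∧ ∀ f ∈ I, Q f = 0}
  add_mem' := by
    rintro Q₁ Q₂ ⟨⟨c₁, hc₁, rfl⟩, h₁⟩ ⟨⟨c₂, hc₂, rfl⟩, h₂⟩
    refine ⟨⟨c₁ + c₂, fun β hβ => by simp [hc₁ β hβ, hc₂ β hβ],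
      (dualApply_add y c₁ c₂).symm⟩,
      fun f hf => by simp [dualApply_add, h₁ f hf, h₂ f hf]⟩
  zero_mem' := ⟨⟨0, fun β _ => rfl, (dualApply_zero y).symm⟩, fun f _ => rfl⟩
  smul_mem' := by
    rintro a Q ⟨⟨c, hc, rfl⟩, h⟩
    exact ⟨⟨a • c, fun β hβ => by simp [hc β hβ], (dualApply_smul y a c).symm⟩,
      fun f hf => by simp [h f hf]⟩
lemma pderiv_mul_mulLeft_X {n : ℕ} (i j : Fin n) :
    ((pderiv j).toLinearMap : Module.End ℂ (MvPolynomial (Fin n) ℂ)) *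
        LinearMap.mulLeft ℂ (X i) =
      LinearMap.mulLeft ℂ (X i) * (pderiv j).toLinearMap + if j = i then 1 else 0 := by
  refine LinearMap.ext fun f => ?_
  by_cases h : j = i
  · subst h
    simp [Module.End.mul_apply, add_comm]
  · simp [Module.End.mul_apply, h, pderiv_X_of_ne (Ne.symm h)]

lemma pderiv_pow_mul_mulLeft_X_of_ne {n : ℕ} {i j : Fin n} (h : j ≠ i) (k : ℕ) :
    ((pderiv j).toLinearMap : Module.End ℂ (MvPolynomial (Fin n) ℂ)) ^ k *
        LinearMap.mulLeft ℂ (X i) =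
      LinearMap.mulLeft ℂ (X i) * (pderiv j).toLinearMap ^ k := by
  have hc : Commute ((pderiv j).toLinearMap : Module.End ℂ (MvPolynomial (Fin n) ℂ))
      (LinearMap.mulLeft ℂ (X i)) := by
    simpa [h, Commute, SemiconjBy] using pderiv_mul_mulLeft_X i j
  exact (hc.pow_left k).eq

lemma pderiv_pow_mul_mulLeft_X_self {n : ℕ} (i : Fin n) (k : ℕ) :
    ((pderiv i).toLinearMap : Module.End ℂ (MvPolynomial (Fin n) ℂ)) ^ k *
        LinearMap.mulLeft ℂ (X i) =
      LinearMap.mulLeft ℂ (X i) * (pderiv i).toLinearMap ^ k +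
        k • (pderiv i).toLinearMap ^ (k - 1) := by
  induction k with
  | zero => simp
  | succ k ih =>
    have h := pderiv_mul_mulLeft_X i i
    rw [if_pos rfl] at h
    rw [pow_succ, mul_assoc, h, mul_add, ← mul_assoc, ih, add_mul, mul_one, mul_assoc, add_assoc]
    congr 1
    cases k with
    | zero => simp
    | succ k =>
      rw [smul_mul_assoc, Nat.add_sub_cancel, Nat.add_sub_cancel, ← pow_succ, ← succ_nsmul]

lemma prod_pderiv_pow_mul_mulLeft_X {n : ℕ} (i : Fin n) (β : Fin n →₀ ℕ) (l : List (Fin n))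
    (hl : l.Nodup) :
    (l.map fun j =>
        ((pderiv j).toLinearMap : Module.End ℂ (MvPolynomial (Fin n) ℂ)) ^ β j).prod *
        LinearMap.mulLeft ℂ (X i) =
      LinearMap.mulLeft ℂ (X i) * (l.map fun j => (pderiv j).toLinearMap ^ β j).prod +
        if i ∈ l then
          β i • (l.map fun j => (pderiv j).toLinearMap ^ (β - Finsupp.single i 1 : Fin n →₀ ℕ) j).prod
        else 0 := by
  induction l with
  | nil => simp
  | cons a l ih =>
    obtain ⟨ha, hl⟩ := List.nodup_cons.mp hl
    rw [List.map_cons, List.prod_cons, mul_assoc, ih hl, mul_add, ← mul_assoc]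
    by_cases h : a = i
    · subst h
      have hmap : (l.map fun j => ((pderiv j).toLinearMap :
            Module.End ℂ (MvPolynomial (Fin n) ℂ)) ^ (β - Finsupp.single a 1 : Fin n →₀ ℕ) j) =
          l.map fun j => (pderiv j).toLinearMap ^ β j := by
        refine List.map_congr_left fun j hj => ?_
        have hja : a ≠ j := fun e => ha (e ▸ hj)
        simp [Finsupp.single_eq_of_ne' hja]
      rw [pderiv_pow_mul_mulLeft_X_self, if_neg ha, if_pos List.mem_cons_self, List.map_cons,
        List.prod_cons, hmap]
      simp [add_mul, mul_assoc]
    · have hia : i ≠ a := Ne.symm h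
      rw [pderiv_pow_mul_mulLeft_X_of_ne h, mul_assoc]
      by_cases hi : i ∈ l
      · simp only [hi, if_true, List.mem_cons_of_mem, List.map_cons, List.prod_cons,
          mul_smul_comm, Finsupp.tsub_apply, Finsupp.single_eq_of_ne' hia, tsub_zero]
      · simp [hi, hia]

lemma pd_X_mul {n : ℕ} (i : Fin n) (β : Fin n →₀ ℕ) (f : MvPolynomial (Fin n) ℂ) :
    pd β (X i * f) = X i * pd β f + β i • pd (β - Finsupp.single i 1) f := by
  have h := prod_pderiv_pow_mul_mulLeft_X i β (List.finRange n) (List.nodup_finRange n)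
  rw [if_pos (List.mem_finRange i)] at h
  simp only [← List.ofFn_eq_map] at h
  exact LinearMap.congr_fun h f

lemma eval_pd_X_sub_C_mul {n : ℕ} (y : Fin n → ℂ) (i : Fin n) (β : Fin n →₀ ℕ)
    (f : MvPolynomial (Fin n) ℂ) :
    eval y (pd β ((X i - C (y i)) * f)) =
      (β i : ℂ) * eval y (pd (β - Finsupp.single i 1) f) := by
  rw [sub_mul, map_sub, pd_X_mul, C_mul', map_smul]
  simp

lemma dualApply_sum_single {n : ℕ} (y : Fin n → ℂ) (c : (Fin n →₀ ℕ) →₀ ℂ)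
    (s : (Fin n →₀ ℕ) → Fin n →₀ ℕ) (a : (Fin n →₀ ℕ) → ℂ) (f : MvPolynomial (Fin n) ℂ) :
    dualApply y (c.sum fun β cβ => Finsupp.single (s β) (cβ * a β)) f =
      c.sum fun β cβ => cβ * a β * eval y (pd (s β) f) := by
  unfold dualApply
  rw [Finsupp.sum_sum_index (fun β => zero_mul _) (fun β b₁ b₂ => add_mul _ _ _)]
  exact Finsupp.sum_congr fun β _ => Finsupp.sum_single_index (zero_mul _)

/-- The dual space `D_y[I]` is stable under the differentiation operators `χ_i`: if
`Q = Σ_β c_β Δ_y^β ∈ D_y[I]`, then `χ_i Q = Σ_β c_β β_i Δ_y^{β − e_i}` also lies in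
`D_y[I]`. -/
theorem chi_mem_dualSpace {n : ℕ} (I : Ideal (MvPolynomial (Fin n) ℂ))
    (y : Fin n → ℂ) (i : Fin n) (c : (Fin n →₀ ℕ) →₀ ℂ)
    (hQ : dualApply y c ∈ DualSpace I y) :
    (fun f : MvPolynomial (Fin n) ℂ =>
        c.sum fun β cβ => cβ * (β i : ℂ) * eval y (pd (β - Finsupp.single i 1) f))
      ∈ DualSpace I y := by
  refine ⟨⟨c.sum fun β cβ => Finsupp.single (β - Finsupp.single i 1) (cβ * (β i : ℂ)), ?_⟩, ?_⟩
  · funext f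
    exact (dualApply_sum_single y c (fun β => β - Finsupp.single i 1) (fun β => (β i : ℂ)) f).symm
  · intro f hf
    rw [← hQ.2 _ (I.mul_mem_left (X i - C (y i)) hf)]
    refine Finsupp.sum_congr fun β _ => ?_
    rw [eval_pd_X_sub_C_mul, mul_assoc]
end NPD
end
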